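/- arXiv:2605.18644 — 2 statements merged into one kernel-verified Lean document; each statement's English description precedes it below -/
import Mathlib

section
/- If C is a distinct covering system with least modulus 4 whose moduli have least common multiple L = 2^a·3^b·5^c, where a, b, c are positive integers with a ≥ b ≥ c, then a ≥ 3. Equivalently, there is no distinct covering system with least modulus 4 and least common multiple of its moduli equal to 2^2·3^2·5^2 = 900. -/
/-- The largest number of elements of `T` in a single residue class modulo `d`. -/
def maxClassCard (T : Finset ℕ) (d : ℕ) : ℕ :=
  (Finset.range d).sup fun r => (T.filter fun t => t % d = r).card

/-- `T` is so evenly spread over residue classes that, even after the loss of `k` elements,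
`T × ℤ/25` has more elements than classes modulo `5 d` and `25 d`, one each for `d ∣ 36`,
can cover. The summand `9` bounds the contribution of `d = 9, 12, 18, 36` when `T` contains no
multiples of `4`. -/
def IsSpread (T : Finset ℕ) (k : ℕ) : Prop :=
  6 * (maxClassCard T 2 + maxClassCard T 3 + maxClassCard T 4 + maxClassCard T 6 + 9) + 19 * k <
    19 * T.card

instance (T : Finset ℕ) (k : ℕ) : Decidable (IsSpread T k) := by
  unfold IsSpread; infer_instance

/-- Residues modulo `36` outside the zero classes modulo `4` and `9`, the class of `a` modulo `6`
and the class of `b` modulo `12`. -/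
def sieved (a b : ℕ) : Finset ℕ :=
  (Finset.range 36).filter fun t => t % 4 ≠ 0 ∧ t % 9 ≠ 0 ∧ t % 6 ≠ a ∧ t % 12 ≠ b

lemma mod_eq_toNat_emod_of_modEq {t d : ℕ} {r : ℤ} (h : (t : ℤ) ≡ r [ZMOD d]) :
    t % d = (r % d).toNat := by
  have h' : ((t % d : ℕ) : ℤ) = r % d := by rw [Int.natCast_mod]; exact h
  omega

lemma card_filter_mod_le_maxClassCard (T : Finset ℕ) {d : ℕ} (hd : 0 < d) (r : ℤ) :
    (T.filter fun t : ℕ => (t : ℤ) ≡ r [ZMOD d]).card ≤ maxClassCard T d := by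
  have hd' : (0 : ℤ) < d := by exact_mod_cast hd
  have h0 := Int.emod_nonneg r hd'.ne'
  have h1 := Int.emod_lt_of_pos r hd'
  refine le_trans (Finset.card_le_card ?_)
    (Finset.le_sup (f := fun r => (T.filter fun t => t % d = r).card)
      (Finset.mem_range.2 (show (r % d).toNat < d by omega)))
  intro t
  simp only [Finset.mem_filter]
  exact fun ⟨ht, h⟩ => ⟨ht, mod_eq_toNat_emod_of_modEq h⟩

lemma maxClassCard_mono {T T' : Finset ℕ} (h : T ⊆ T') (d : ℕ) :
    maxClassCard T d ≤ maxClassCard T' d :=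
  Finset.sup_mono_fun fun _ _ => Finset.card_le_card (Finset.filter_subset_filter _ h)

lemma IsSpread.of_subset {T T' : Finset ℕ} {j k : ℕ} (hT' : IsSpread T' (j + k)) (h : T ⊆ T')
    (hk : T'.card ≤ T.card + j) : IsSpread T k := by
  have h2 := maxClassCard_mono h 2
  have h3 := maxClassCard_mono h 3
  have h4 := maxClassCard_mono h 4
  have h6 := maxClassCard_mono h 6
  unfold IsSpread at *
  omega

lemma card_le_card_filter_add {T : Finset ℕ} {d j : ℕ} (hT : T ⊆ Finset.range 36)
    (hd : ∀ r < d, ((Finset.range 36).filter fun t => t % d = r).card ≤ j) {c : ℕ} (hc : c < d) :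
    T.card ≤ (T.filter fun t => t % d ≠ c).card + j := by
  have h1 := Finset.card_filter_add_card_filter_not (s := T) (fun t => t % d = c)
  have h2 := Finset.card_le_card (Finset.filter_subset_filter (fun t => t % d = c) hT)
  have := hd c hc
  simp only [ne_eq]
  omega

lemma isSpread_sieved_cases : ∀ a < 6, ∀ b < 12, IsSpread (sieved a b) 3 ∨
    ∀ c < 18, IsSpread ((sieved a b).filter fun t => t % 18 ≠ c) 1 := by
  decide +kernel

lemma isSpread_sieved {a b c e : ℕ} (ha : a < 6) (hb : b < 12) (hc : c < 18) (he : e < 36) :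
    IsSpread (((sieved a b).filter fun t => t % 18 ≠ c).filter fun t => t % 36 ≠ e) 0 := by
  have hsub : sieved a b ⊆ Finset.range 36 := Finset.filter_subset _ _
  have h18 : (sieved a b).card ≤ ((sieved a b).filter fun t => t % 18 ≠ c).card + 2 :=
    card_le_card_filter_add hsub (by decide) hc
  have h36 : ((sieved a b).filter fun t => t % 18 ≠ c).card ≤
      (((sieved a b).filter fun t => t % 18 ≠ c).filter fun t => t % 36 ≠ e).card + 1 :=
    card_le_card_filter_add ((Finset.filter_subset _ _).trans hsub) (by decide) he
  rcases isSpread_sieved_cases a ha b hb with h | h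
  · exact (IsSpread.of_subset (j := 2) (k := 1) h (Finset.filter_subset _ _) h18).of_subset
      (j := 1) (Finset.filter_subset _ _) h36
  · exact (h c hc).of_subset (j := 1) (Finset.filter_subset _ _) h36

/-- The moduli `5 d` and `25 d` with `d ∣ 36`. -/
def fiveMultiples : Finset ℕ :=
  {5, 10, 15, 20, 30, 45, 60, 90, 180, 25, 50, 75, 100, 150, 225, 300, 450, 900}

lemma mem_fiveMultiples {n : ℕ} (hn : n ∣ 900) (h4 : 4 ≤ n) :
    n ∈ fiveMultiples ∨ n ∈ ({4, 6, 9, 12, 18, 36} : Finset ℕ) := by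
  have key : ∀ m ∈ Nat.divisors 900, 4 ≤ m →
      m ∈ fiveMultiples ∨ m ∈ ({4, 6, 9, 12, 18, 36} : Finset ℕ) := by decide +kernel
  exact key n (Nat.mem_divisors.2 ⟨hn, by norm_num⟩) h4

/-- By the Chinese remainder theorem, `325 t + 576 s` is `t` modulo `36` and `s` modulo `25`. -/
lemma exists_not_modEq_fiveMultiples (r : ℕ → ℤ) {T : Finset ℕ} (hT : IsSpread T 0)
    (hT4 : T ⊆ (Finset.range 36).filter fun t => t % 4 ≠ 0) :
    ∃ t ∈ T, ∃ s : ℕ, ∀ n ∈ fiveMultiples, ¬ (325 * t + 576 * s : ℤ) ≡ r n [ZMOD n] := by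
  by_contra! hcon
  have hsub : T ×ˢ Finset.range 25 ⊆ fiveMultiples.biUnion fun n =>
      (T.filter fun t : ℕ => (t : ℤ) ≡ r n [ZMOD (n.gcd 36 : ℕ)]) ×ˢ
        ((Finset.range 25).filter fun s : ℕ => (s : ℤ) ≡ r n [ZMOD (n.gcd 25 : ℕ)]) := by
    rintro ⟨t, s⟩ hts
    obtain ⟨ht, hs⟩ := Finset.mem_product.1 hts
    obtain ⟨n, hn, hx⟩ := hcon t ht s
    refine Finset.mem_biUnion.2 ⟨n, hn, Finset.mem_product.2
      ⟨Finset.mem_filter.2 ⟨ht, ?_⟩, Finset.mem_filter.2 ⟨hs, ?_⟩⟩⟩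
    · have h36 : (t : ℤ) ≡ 325 * t + 576 * s [ZMOD 36] :=
        (Int.modEq_iff_dvd).2 ⟨9 * t + 16 * s, by ring⟩
      exact (h36.of_dvd (by exact_mod_cast n.gcd_dvd_right 36)).trans
        (hx.of_dvd (by exact_mod_cast n.gcd_dvd_left 36))
    · have h25 : (s : ℤ) ≡ 325 * t + 576 * s [ZMOD 25] :=
        (Int.modEq_iff_dvd).2 ⟨13 * t + 23 * s, by ring⟩
      exact (h25.of_dvd (by exact_mod_cast n.gcd_dvd_right 25)).trans
        (hx.of_dvd (by exact_mod_cast n.gcd_dvd_left 25))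
  have hcard := (Finset.card_le_card hsub).trans Finset.card_biUnion_le
  have hbound : ∀ n ∈ fiveMultiples,
      ((T.filter fun t : ℕ => (t : ℤ) ≡ r n [ZMOD (n.gcd 36 : ℕ)]) ×ˢ
        ((Finset.range 25).filter fun s : ℕ => (s : ℤ) ≡ r n [ZMOD (n.gcd 25 : ℕ)])).card ≤
      maxClassCard T (n.gcd 36) * maxClassCard (Finset.range 25) (n.gcd 25) := by
    intro n _
    rw [Finset.card_product]
    exact Nat.mul_le_mul
      (card_filter_mod_le_maxClassCard T (Nat.gcd_pos_of_pos_right n (by norm_num)) _)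
      (card_filter_mod_le_maxClassCard _ (Nat.gcd_pos_of_pos_right n (by norm_num)) _)
  have h5 : maxClassCard (Finset.range 25) 5 = 5 := by decide +kernel
  have h25 : maxClassCard (Finset.range 25) 25 = 1 := by decide +kernel
  have h9 : maxClassCard T 9 ≤ 3 := (maxClassCard_mono hT4 9).trans (by decide +kernel)
  have h12 : maxClassCard T 12 ≤ 3 := (maxClassCard_mono hT4 12).trans (by decide +kernel)
  have h18 : maxClassCard T 18 ≤ 2 := (maxClassCard_mono hT4 18).trans (by decide +kernel)
  have h36 : maxClassCard T 36 ≤ 1 := (maxClassCard_mono hT4 36).trans (by decide +kernel)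
  have h1 : maxClassCard T 1 = T.card := by simp [maxClassCard, Nat.mod_one]
  have hle := hcard.trans (Finset.sum_le_sum hbound)
  rw [Finset.card_product, Finset.card_range] at hle
  unfold IsSpread at hT
  simp [fiveMultiples, h5, h25, h1] at hle
  omega

lemma exists_not_modEq (r : ℕ → ℤ) (h4 : r 4 ≡ 0 [ZMOD 4]) (h9 : r 9 ≡ 0 [ZMOD 9]) :
    ∃ x : ℤ, ∀ n : ℕ, n ∣ 900 → 4 ≤ n → ¬ x ≡ r n [ZMOD n] := by
  obtain ⟨t, ht, s, hts⟩ := exists_not_modEq_fiveMultiples r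
    (isSpread_sieved (a := (r 6 % 6).toNat) (b := (r 12 % 12).toNat) (c := (r 18 % 18).toNat)
      (e := (r 36 % 36).toNat) (by omega) (by omega) (by omega) (by omega))
    (fun t ht => by
      simp only [sieved, Finset.mem_filter] at ht ⊢
      exact ⟨ht.1.1.1, ht.1.1.2.1⟩)
  simp only [sieved, Finset.mem_filter] at ht
  obtain ⟨⟨⟨-, ht4, ht9, ht6, ht12⟩, ht18⟩, ht36⟩ := ht
  have hx36 : (325 * t + 576 * s : ℤ) ≡ t [ZMOD 36] :=
    (Int.modEq_iff_dvd).2 ⟨-(9 * t + 16 * s), by ring⟩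
  have hmod {d : ℕ} {ρ : ℤ} (hd : d ∣ 36) (h : (325 * t + 576 * s : ℤ) ≡ ρ [ZMOD d]) :
      t % d = (ρ % d).toNat :=
    mod_eq_toNat_emod_of_modEq ((hx36.of_dvd (by exact_mod_cast hd)).symm.trans h)
  refine ⟨325 * t + 576 * s, fun n hn hn4 hx => ?_⟩
  rcases mem_fiveMultiples hn hn4 with h | h
  · exact hts n h hx
  · simp only [Finset.mem_insert, Finset.mem_singleton] at h
    rcases h with rfl | rfl | rfl | rfl | rfl | rfl
    · exact ht4 (hmod (by norm_num) (hx.trans h4))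
    · exact ht6 (hmod (by norm_num) hx)
    · exact ht9 (hmod (by norm_num) (hx.trans h9))
    · exact ht12 (hmod (by norm_num) hx)
    · exact ht18 (hmod (by norm_num) hx)
    · exact ht36 (hmod (by norm_num) hx)

/-- If C is a distinct covering system with least modulus 4 whose moduli have lcm 2^a * 3^b * 5^c with a ≥ b ≥ c ≥ 1, then a ≥ 3 (equivalently, there is no such covering with lcm 2^2 * 3^2 * 5^2 = 900). -/
theorem m4_implies_a_ge_three (S : Finset ℕ) (r : ℕ → ℤ) (a b c : ℕ)
    (hmod : ∀ n ∈ S, 1 < n)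
    (hcov : ∀ x : ℤ, ∃ n ∈ S, x ≡ r n [ZMOD (n : ℤ)])
    (hm : 4 ∈ S) (hmin : ∀ n ∈ S, 4 ≤ n)
    (hlcm : S.lcm id = 2 ^ a * 3 ^ b * 5 ^ c)
    (ha : 1 ≤ a) (hb : 1 ≤ b) (hc : 1 ≤ c) (hab : b ≤ a) (hbc : c ≤ b) :
    3 ≤ a := by
  by_contra! ha3
  have hdvd : ∀ n ∈ S, n ∣ 900 := fun n hn => by
    have h : n ∣ S.lcm id := Finset.dvd_lcm (f := id) hn
    rw [hlcm] at h
    exact h.trans (mul_dvd_mul (mul_dvd_mul (pow_dvd_pow 2 (show a ≤ 2 by omega))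
      (pow_dvd_pow 3 (show b ≤ 2 by omega))) (pow_dvd_pow 5 (show c ≤ 2 by omega)))
  set y : ℤ := 9 * r 4 - 8 * r 9 with hy
  obtain ⟨x, hx⟩ := exists_not_modEq (fun n => r n - y)
    ((Int.modEq_iff_dvd).2 ⟨2 * r 4 - 2 * r 9, by rw [hy]; ring⟩)
    ((Int.modEq_iff_dvd).2 ⟨r 4 - r 9, by rw [hy]; ring⟩)
  obtain ⟨n, hn, h⟩ := hcov (x + y)
  refine hx n (hdvd n hn) (hmin n hn) ?_
  simpa using h.sub_right y
end

section
/- There exists a distinct covering system with least modulus 4 whose moduli have least common multiple equal to 2^5·3·5 = 480 and which contains no congruence with modulus 240. -/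
/-- A distinct covering system, as a list of pairs (modulus, residue). -/
def coveringList : List (ℕ × ℤ) :=
  [(4, 1), (5, 1), (6, 0), (8, 7), (10, 2), (12, 8), (15, 4), (16, 11), (20, 18), (24, 2),
    (30, 10), (32, 19), (40, 30), (48, 3), (60, 28), (80, 3), (96, 35), (120, 14), (160, 35),
    (480, 67)]

/-- The residue attached to a modulus of `coveringList`, and `0` for any other number. -/
def coveringResidue (n : ℕ) : ℤ :=
  (coveringList.lookup n).getD 0

/-- The set of moduli of `coveringList`. -/
def coveringModuli : Finset ℕ :=
  (coveringList.map Prod.fst).toFinset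

theorem dvd_of_mem_coveringModuli : ∀ n ∈ coveringModuli, n ∣ 480 := by
  decide

theorem coveringModuli_covers_lt :
    ∀ k : ℕ, k < 480 → ∃ n ∈ coveringModuli, (k : ℤ) % n = coveringResidue n % n := by
  decide +kernel

/-- Covering a full period suffices, since every modulus divides `480`. -/
theorem coveringModuli_covers (x : ℤ) :
    ∃ n ∈ coveringModuli, x ≡ coveringResidue n [ZMOD (n : ℤ)] := by
  obtain ⟨n, hn, h⟩ := coveringModuli_covers_lt (x % 480).toNat (by omega)
  refine ⟨n, hn, ?_⟩
  rw [Int.toNat_of_nonneg (by omega),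
    Int.emod_emod_of_dvd x (by exact_mod_cast dvd_of_mem_coveringModuli n hn)] at h
  exact h

/-- There exists a distinct covering system with least modulus 4, lcm of moduli 2^5 * 3 * 5 = 480, containing no congruence with modulus 240. -/
theorem exists_covering_m4_L480_no240 :
    ∃ (S : Finset ℕ) (r : ℕ → ℤ),
      (∀ n ∈ S, 1 < n) ∧
      (∀ x : ℤ, ∃ n ∈ S, x ≡ r n [ZMOD (n : ℤ)]) ∧
      (4 ∈ S ∧ ∀ n ∈ S, 4 ≤ n) ∧
      S.lcm id = 2 ^ 5 * 3 * 5 ∧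
      240 ∉ S := by
  refine ⟨coveringModuli, coveringResidue, by decide, coveringModuli_covers,
    ⟨by decide, by decide⟩, ?_, by decide⟩
  exact Nat.dvd_antisymm (Finset.lcm_dvd dvd_of_mem_coveringModuli)
    (Finset.dvd_lcm (f := id) (by decide : 480 ∈ coveringModuli))
end
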